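/- For every number of arms k ≥ 1 and every horizon n ≥ 1, and for every prior probability distribution Q over k-armed bandit environments, the Thompson Sampling policy has Bayesian regret satisfying BR*_n(Q) ≤ 14·√(k·n); that is, Thompson Sampling admits a prior-independent Bayesian regret upper bound of 14√(kn). -/

import Mathlib

open MeasureTheory ProbabilityTheory

namespace Bandit

/-- History of `t` rounds of interaction: the arm played and the reward observed
in each of the `t` rounds. -/
abbrev Hist (k t : ℕ) := Fin t → Fin k × ℝ

/-- A (possibly randomized, measurable) policy for a `k`-armed bandit:
at each round `t`, given the history of previously selected arms and observed rewards,
it selects the next arm according to a probability distribution, measurably in the history. -/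
structure Policy (k : ℕ) where
  act : ∀ t : ℕ, Hist k t → Measure (Fin k)
  measurable_act : ∀ t, Measurable (act t)
  prob_act : ∀ t h, IsProbabilityMeasure (act t h)

/-- The distribution of the history after `t` rounds of interaction between the
action rule `act` and the bandit environment with mean-reward vector `θ`, where the
reward observed upon playing arm `a` is `θ a` plus independent standard Gaussian noise. -/
noncomputable def traj {k : ℕ} (θ : Fin k → ℝ) (act : ∀ t : ℕ, Hist k t → Measure (Fin k)) :
    ∀ t : ℕ, Measure (Hist k t)
  | 0 => Measure.dirac Fin.elim0
  | t + 1 =>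
      (traj θ act t).bind fun h =>
        (act t h).bind fun a =>
          (gaussianReal (θ a) 1).map fun r => Fin.snoc h (a, r)

/-- The Bayesian `n`-round regret of the action rule `act` under the prior `Q` on
environments: the expectation, over `θ ∼ Q` and over the interaction (the Gaussian
noise and the policy's internal randomization), of the sum over the `n` rounds of the
gap between the best mean reward and the mean reward of the selected arm. -/
noncomputable def bayesRegret (k n : ℕ) (Q : Measure (Fin k → ℝ))
    (act : ∀ t : ℕ, Hist k t → Measure (Fin k)) : ℝ :=
  ∫ θ, (∫ h, (∑ t : Fin n, ((⨆ a, θ a) - θ (h t).1)) ∂(traj θ act n)) ∂Q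

end Bandit

namespace Bandit

/-- The posterior distribution over environments, given the prior `Q` and a history `h`
of selected arms and observed rewards, where the reward observed upon playing arm `a` in
environment `θ` is `θ a` plus independent standard Gaussian noise: the prior reweighted by
the Gaussian likelihood of the observed rewards, renormalized. -/
noncomputable def posterior {k : ℕ} (Q : Measure (Fin k → ℝ)) {t : ℕ} (h : Hist k t) :
    Measure (Fin k → ℝ) :=
  let ν := Q.withDensity fun θ =>
    ∏ s : Fin t, ENNReal.ofReal (gaussianPDFReal (θ (h s).1) 1 (h s).2)
  (ν Set.univ)⁻¹ • ν

open Classical in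
/-- The arm with the largest mean reward in environment `θ` (ties broken towards the
smallest index). -/
noncomputable def bestArm {k : ℕ} [NeZero k] (θ : Fin k → ℝ) : Fin k :=
  if hmax : (Finset.univ.filter fun a => ∀ b, θ b ≤ θ a).Nonempty then
    (Finset.univ.filter fun a => ∀ b, θ b ≤ θ a).min' hmax
  else ⟨0, Nat.pos_of_ne_zero (NeZero.ne k)⟩

/-- The action distribution of the Thompson Sampling policy under the prior `Q`: given the
history `h`, each arm `a` is selected with probability equal to the posterior probability
that `a` has the largest mean reward. -/
noncomputable def tsAct {k : ℕ} [NeZero k] (Q : Measure (Fin k → ℝ)) {t : ℕ}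
    (h : Hist k t) : Measure (Fin k) :=
  (posterior Q h).map bestArm

end Bandit
open scoped ENNReal

namespace Bandit

section BestArm

variable {k : ℕ} [NeZero k]

theorem nonempty_filter_forall_le (θ : Fin k → ℝ) [DecidablePred fun a => ∀ b, θ b ≤ θ a] :
    (Finset.univ.filter fun a => ∀ b, θ b ≤ θ a).Nonempty := by
  obtain ⟨a, ha⟩ := Finite.exists_max θ
  exact ⟨a, by simpa using ha⟩

theorem le_bestArm (θ : Fin k → ℝ) (b : Fin k) : θ b ≤ θ (bestArm θ) := by
  classical
  rw [bestArm, dif_pos (nonempty_filter_forall_le θ)]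
  have h := Finset.min'_mem _ (nonempty_filter_forall_le θ)
  exact (Finset.mem_filter.mp h).2 b

theorem bestArm_eq_iff (θ : Fin k → ℝ) (a : Fin k) :
    bestArm θ = a ↔ (∀ b, θ b ≤ θ a) ∧ ∀ c < a, ∃ b, θ c < θ b := by
  classical
  constructor
  · rintro rfl
    refine ⟨le_bestArm θ, fun c hc => ?_⟩
    by_contra! hcon
    rw [bestArm, dif_pos (nonempty_filter_forall_le θ)] at hc
    exact absurd (Finset.min'_le _ c (by simpa using hcon)) (not_le.mpr hc)
  · rintro ⟨h1, h2⟩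
    rw [bestArm, dif_pos (nonempty_filter_forall_le θ)]
    refine le_antisymm (Finset.min'_le _ a (by simpa using h1)) ?_
    refine Finset.le_min' _ _ _ fun c hc => ?_
    by_contra! hca
    obtain ⟨b, hb⟩ := h2 c hca
    exact absurd ((Finset.mem_filter.mp hc).2 b) (not_le.mpr hb)

theorem measurable_bestArm : Measurable (bestArm : (Fin k → ℝ) → Fin k) := by
  refine measurable_to_countable' fun a => ?_
  have : (bestArm : (Fin k → ℝ) → Fin k) ⁻¹' {a} =
      {θ | (∀ b, θ b ≤ θ a) ∧ ∀ c < a, ∃ b, θ c < θ b} := by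
    ext θ
    exact bestArm_eq_iff θ a
  rw [this]
  simp only [Set.ofPred_and, Set.ofPred_forall, Set.ofPred_exists]
  refine MeasurableSet.inter (MeasurableSet.iInter fun b => ?_)
    (MeasurableSet.iInter fun c => MeasurableSet.iInter fun _ => MeasurableSet.iUnion fun b => ?_)
  · exact measurableSet_le (measurable_pi_apply b) (measurable_pi_apply a)
  · exact measurableSet_lt (measurable_pi_apply c) (measurable_pi_apply b)

theorem iSup_eq_bestArm (θ : Fin k → ℝ) : ⨆ a, θ a = θ (bestArm θ) :=
  le_antisymm (ciSup_le (le_bestArm θ)) (le_ciSup (Set.finite_range θ).bddAbove _)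

theorem measurable_apply_bestArm : Measurable fun θ : Fin k → ℝ => θ (bestArm θ) := by
  simp_rw [← iSup_eq_bestArm]
  exact Measurable.iSup fun a => measurable_pi_apply a

end BestArm

section Posterior

variable {k : ℕ}

/-- The likelihood of the rewards observed in the history `h` under the environment `θ`. -/
noncomputable def likelihood {t : ℕ} (θ : Fin k → ℝ) (h : Hist k t) : ℝ≥0∞ :=
  ∏ s : Fin t, ENNReal.ofReal (gaussianPDFReal (θ (h s).1) 1 (h s).2)

theorem measurable_apply_prod : Measurable fun z : (Fin k → ℝ) × Fin k => z.1 z.2 :=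
  measurable_from_prod_countable_left fun a => measurable_pi_apply a

theorem measurable_gaussianPDFReal_comp {α : Type*} [MeasurableSpace α] {f g : α → ℝ}
    (hf : Measurable f) (hg : Measurable g) :
    Measurable fun z => gaussianPDFReal (f z) 1 (g z) := by
  unfold gaussianPDFReal
  fun_prop

theorem gaussianPDFReal_one_le_one (m x : ℝ) : gaussianPDFReal m 1 x ≤ 1 := by
  unfold gaussianPDFReal
  refine mul_le_one₀ (inv_le_one_of_one_le₀ ?_) (Real.exp_pos _).le ?_
  · rw [Real.one_le_sqrt]
    simp only [NNReal.coe_one, mul_one]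
    linarith [Real.pi_gt_three]
  · rw [Real.exp_le_one_iff, neg_div]
    exact neg_nonpos.mpr (by positivity)

theorem measurable_likelihood_comp {t : ℕ} {α : Type*} [MeasurableSpace α]
    {f : α → Fin k → ℝ} {g : α → Hist k t} (hf : Measurable f) (hg : Measurable g) :
    Measurable fun z => likelihood (f z) (g z) := by
  unfold likelihood
  refine Finset.measurable_prod _ fun s _ => Measurable.ennreal_ofReal ?_
  have hs : Measurable fun z => g z s := (measurable_pi_apply s).comp hg
  exact measurable_gaussianPDFReal_comp (measurable_apply_prod.comp (hf.prodMk hs.fst)) hs.snd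

theorem measurable_likelihood {t : ℕ} :
    Measurable fun z : (Fin k → ℝ) × Hist k t => likelihood z.1 z.2 :=
  measurable_likelihood_comp measurable_fst measurable_snd

theorem measurable_likelihood_left {t : ℕ} (h : Hist k t) :
    Measurable fun θ : Fin k → ℝ => likelihood θ h :=
  measurable_likelihood_comp measurable_id measurable_const

theorem likelihood_le_one {t : ℕ} (θ : Fin k → ℝ) (h : Hist k t) : likelihood θ h ≤ 1 :=
  Finset.prod_le_one' fun _ _ => ENNReal.ofReal_le_one.mpr (gaussianPDFReal_one_le_one _ _)

theorem likelihood_ne_zero {t : ℕ} (θ : Fin k → ℝ) (h : Hist k t) : likelihood θ h ≠ 0 :=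
  Finset.prod_ne_zero_iff.mpr fun _ _ =>
    (ENNReal.ofReal_pos.mpr (gaussianPDFReal_pos _ _ _ one_ne_zero)).ne'

theorem likelihood_snoc {t : ℕ} (θ : Fin k → ℝ) (h : Hist k t) (a : Fin k) (x : ℝ) :
    likelihood θ (Fin.snoc h (a, x) : Hist k (t + 1)) =
      likelihood θ h * ENNReal.ofReal (gaussianPDFReal (θ a) 1 x) := by
  simp [likelihood, Fin.prod_univ_castSucc]

variable (Q : Measure (Fin k → ℝ))

/-- The marginal likelihood of the rewards observed in the history `h` under the prior `Q`. -/
noncomputable def evidence {t : ℕ} (h : Hist k t) : ℝ≥0∞ := ∫⁻ θ, likelihood θ h ∂Q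

theorem posterior_eq {t : ℕ} (h : Hist k t) :
    posterior Q h = (evidence Q h)⁻¹ • Q.withDensity fun θ => likelihood θ h := by
  simp only [posterior, evidence, likelihood, withDensity_apply _ MeasurableSet.univ,
    Measure.restrict_univ]

theorem lintegral_posterior {t : ℕ} (h : Hist k t) {f : (Fin k → ℝ) → ℝ≥0∞} (hf : Measurable f) :
    ∫⁻ θ, f θ ∂posterior Q h = (evidence Q h)⁻¹ * ∫⁻ θ, likelihood θ h * f θ ∂Q := by
  rw [posterior_eq, lintegral_smul_measure,
    lintegral_withDensity_eq_lintegral_mul _ (measurable_likelihood_left h) hf]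
  rfl

theorem posterior_absolutelyContinuous {t : ℕ} (h : Hist k t) : posterior Q h ≪ Q := by
  rw [posterior_eq]
  exact (Measure.smul_absolutelyContinuous).trans (withDensity_absolutelyContinuous _ _)

variable [IsProbabilityMeasure Q]

theorem evidence_ne_top {t : ℕ} (h : Hist k t) : evidence Q h ≠ ∞ := by
  refine ne_top_of_le_ne_top ENNReal.one_ne_top
    ((lintegral_mono fun θ => likelihood_le_one θ h).trans ?_)
  simp

theorem evidence_ne_zero {t : ℕ} (h : Hist k t) : evidence Q h ≠ 0 := by
  rw [evidence, Ne, lintegral_eq_zero_iff (measurable_likelihood_left h)]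
  intro h0
  obtain ⟨θ, hθ⟩ := h0.exists
  exact likelihood_ne_zero θ h hθ

theorem evidence_mul_lintegral_posterior {t : ℕ} (h : Hist k t) {f : (Fin k → ℝ) → ℝ≥0∞}
    (hf : Measurable f) :
    evidence Q h * ∫⁻ θ, f θ ∂posterior Q h = ∫⁻ θ, likelihood θ h * f θ ∂Q := by
  rw [lintegral_posterior Q h hf, ← mul_assoc,
    ENNReal.mul_inv_cancel (evidence_ne_zero Q h) (evidence_ne_top Q h), one_mul]

instance isProbabilityMeasure_posterior {t : ℕ} (h : Hist k t) :
    IsProbabilityMeasure (posterior Q h) := by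
  constructor
  rw [← lintegral_one, lintegral_posterior Q h measurable_const]
  simpa [evidence] using ENNReal.inv_mul_cancel (evidence_ne_zero Q h) (evidence_ne_top Q h)

theorem measurable_evidence {t : ℕ} : Measurable fun h : Hist k t => evidence Q h :=
  measurable_likelihood.lintegral_prod_left'

theorem measurable_lintegral_posterior {t : ℕ} {f : (Fin k → ℝ) × Hist k t → ℝ≥0∞}
    (hf : Measurable f) : Measurable fun h : Hist k t => ∫⁻ θ, f (θ, h) ∂posterior Q h := by
  have : (fun h : Hist k t => ∫⁻ θ, f (θ, h) ∂posterior Q h) =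
      fun h => (evidence Q h)⁻¹ * ∫⁻ θ, likelihood θ h * f (θ, h) ∂Q := by
    ext h
    exact lintegral_posterior Q h (hf.comp measurable_prodMk_right)
  rw [this]
  exact (measurable_evidence Q).inv.mul (measurable_likelihood.mul hf).lintegral_prod_left'

theorem posterior_apply_snoc {t : ℕ} (h : Hist k t) (a : Fin k) (x : ℝ) {s : Set (Fin k → ℝ)}
    (hs : MeasurableSet s) :
    posterior Q (Fin.snoc h (a, x) : Hist k (t + 1)) s =
      (∫⁻ θ, ENNReal.ofReal (gaussianPDFReal (θ a) 1 x) ∂posterior Q h)⁻¹ *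
        ∫⁻ θ in s, ENNReal.ofReal (gaussianPDFReal (θ a) 1 x) ∂posterior Q h := by
  have hg : Measurable fun θ : Fin k → ℝ => ENNReal.ofReal (gaussianPDFReal (θ a) 1 x) :=
    (measurable_gaussianPDFReal_comp (measurable_pi_apply a) measurable_const).ennreal_ofReal
  have hZ := evidence_mul_lintegral_posterior Q h hg
  have hE : evidence Q (Fin.snoc h (a, x) : Hist k (t + 1)) =
      evidence Q h * ∫⁻ θ, ENNReal.ofReal (gaussianPDFReal (θ a) 1 x) ∂posterior Q h := by
    rw [hZ]
    simp only [evidence, likelihood_snoc]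
  rw [← lintegral_indicator hs, ← lintegral_indicator_one hs,
    lintegral_posterior Q _ (measurable_one.indicator hs), hE,
    ENNReal.mul_inv (.inl (evidence_ne_zero Q h)) (.inl (evidence_ne_top Q h)),
    mul_comm (evidence Q h)⁻¹, mul_assoc]
  rw [lintegral_posterior Q h (hg.indicator hs)]
  congr 2
  refine lintegral_congr fun θ => ?_
  by_cases hθ : θ ∈ s <;> simp [hθ, likelihood_snoc]

end Posterior

section ThompsonSampling

variable {k : ℕ} [NeZero k] (Q : Measure (Fin k → ℝ)) [IsProbabilityMeasure Q]

instance isProbabilityMeasure_tsAct {t : ℕ} (h : Hist k t) : IsProbabilityMeasure (tsAct Q h) :=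
  Measure.isProbabilityMeasure_map measurable_bestArm.aemeasurable

omit [IsProbabilityMeasure Q] in
theorem tsAct_apply_singleton {t : ℕ} (h : Hist k t) (a : Fin k) :
    tsAct Q h {a} = posterior Q h (bestArm ⁻¹' {a}) :=
  Measure.map_apply measurable_bestArm (measurableSet_singleton a)

theorem measurable_tsAct {t : ℕ} : Measurable fun h : Hist k t => tsAct Q h := by
  refine Measure.measurable_of_measurable_coe _ fun s hs => ?_
  have hs' : MeasurableSet (bestArm ⁻¹' s : Set (Fin k → ℝ)) := measurable_bestArm hs
  have : (fun h : Hist k t => tsAct Q h s) =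
      fun h => ∫⁻ θ, (bestArm ⁻¹' s).indicator 1 θ ∂posterior Q h := by
    ext h
    rw [lintegral_indicator_one hs', tsAct, Measure.map_apply measurable_bestArm hs]
  rw [this]
  exact measurable_lintegral_posterior Q
    ((measurable_one.indicator hs').comp measurable_fst)

/-- Thompson Sampling under the prior `Q`, as a policy. -/
noncomputable def tsPolicy : Policy k where
  act _ h := tsAct Q h
  measurable_act _ := measurable_tsAct Q
  prob_act _ h := isProbabilityMeasure_tsAct Q h

end ThompsonSampling

section Trajectory

variable {k : ℕ}

theorem measurable_snoc {t : ℕ} :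
    Measurable fun z : Hist k t × (Fin k × ℝ) => (Fin.snoc z.1 z.2 : Hist k (t + 1)) := by
  fun_prop

theorem measurable_snoc_apply {t : ℕ} (a : Fin k) :
    Measurable fun z : Hist k t × ℝ => (Fin.snoc z.1 (a, z.2) : Hist k (t + 1)) :=
  measurable_snoc.comp (measurable_fst.prodMk (measurable_const.prodMk measurable_snd))

theorem measurable_snoc_right {t : ℕ} (h : Hist k t) (a : Fin k) :
    Measurable fun x : ℝ => (Fin.snoc h (a, x) : Hist k (t + 1)) :=
  (measurable_snoc_apply a).comp measurable_prodMk_left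

theorem lintegral_bind_map_snoc (θ : Fin k → ℝ) (μ : Measure (Fin k)) {t : ℕ} (h : Hist k t)
    {f : Hist k (t + 1) → ℝ≥0∞} (hf : Measurable f) :
    ∫⁻ h', f h' ∂(μ.bind fun a => (gaussianReal (θ a) 1).map fun r => Fin.snoc h (a, r)) =
      ∑ a, μ {a} * ∫⁻ x, f (Fin.snoc h (a, x)) ∂gaussianReal (θ a) 1 := by
  rw [Measure.lintegral_bind (measurable_of_finite _).aemeasurable hf.aemeasurable,
    lintegral_fintype]
  refine Finset.sum_congr rfl fun a _ => ?_
  rw [lintegral_map hf (measurable_snoc_right h a), mul_comm]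

theorem measurable_bind_map_snoc (θ : Fin k → ℝ) (π : Policy k) (t : ℕ) :
    Measurable fun h : Hist k t => (π.act t h).bind fun a =>
      (gaussianReal (θ a) 1).map fun r => (Fin.snoc h (a, r) : Hist k (t + 1)) := by
  refine Measure.measurable_of_measurable_coe _ fun s hs => ?_
  simp_rw [← lintegral_indicator_one hs]
  have hf : Measurable (s.indicator (1 : Hist k (t + 1) → ℝ≥0∞)) := measurable_one.indicator hs
  simp_rw [fun h => lintegral_bind_map_snoc θ (π.act t h) h hf]
  refine Finset.measurable_sum _ fun a _ => Measurable.mul ?_ ?_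
  · exact (Measure.measurable_coe (measurableSet_singleton a)).comp (π.measurable_act t)
  · exact Measurable.lintegral_prod_right (f := fun h x => s.indicator 1 (Fin.snoc h (a, x)))
      (hf.comp (measurable_snoc_apply a))

theorem lintegral_traj_succ (θ : Fin k → ℝ) (π : Policy k) (t : ℕ)
    {f : Hist k (t + 1) → ℝ≥0∞} (hf : Measurable f) :
    ∫⁻ h, f h ∂traj θ π.act (t + 1) =
      ∫⁻ h, ∑ a, π.act t h {a} * ∫⁻ x, f (Fin.snoc h (a, x)) ∂gaussianReal (θ a) 1
        ∂traj θ π.act t := by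
  rw [traj, Measure.lintegral_bind (measurable_bind_map_snoc θ π t).aemeasurable hf.aemeasurable]
  exact lintegral_congr fun h => lintegral_bind_map_snoc θ _ h hf

theorem sum_act_singleton (π : Policy k) (t : ℕ) (h : Hist k t) : ∑ a, π.act t h {a} = 1 := by
  have := π.prob_act t h
  rw [sum_measure_singleton, Finset.coe_univ, measure_univ]

instance isProbabilityMeasure_traj (θ : Fin k → ℝ) (π : Policy k) (t : ℕ) :
    IsProbabilityMeasure (traj θ π.act t) := by
  induction t with
  | zero => rw [traj]; infer_instance
  | succ t ih =>
    constructor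
    rw [← lintegral_one, lintegral_traj_succ θ π t measurable_const]
    simp only [lintegral_one, measure_univ, mul_one, sum_act_singleton]

/-- The law of the history under `π` with the Gaussian reward distributions replaced by Lebesgue
measure, which dominates the law of the history in every environment. -/
noncomputable def refMeasure (π : Policy k) : ∀ t : ℕ, Measure (Hist k t)
  | 0 => Measure.dirac Fin.elim0
  | t + 1 =>
      (((refMeasure π t).prod ((Measure.count : Measure (Fin k)).prod volume)).withDensity
        fun z => π.act t z.1 {z.2.1}).map fun z => Fin.snoc z.1 z.2

instance sFinite_refMeasure (π : Policy k) (t : ℕ) : SFinite (refMeasure π t) := by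
  induction t with
  | zero => rw [refMeasure]; infer_instance
  | succ t ih => rw [refMeasure]; infer_instance

theorem measurable_act_singleton (π : Policy k) (t : ℕ) :
    Measurable fun z : Hist k t × (Fin k × ℝ) => π.act t z.1 {z.2.1} := by
  have : Measurable fun z : Hist k t × Fin k => π.act t z.1 {z.2} :=
    measurable_from_prod_countable_left fun a =>
      (Measure.measurable_coe (measurableSet_singleton a)).comp (π.measurable_act t)
  exact this.comp (measurable_fst.prodMk measurable_snd.fst)

theorem lintegral_refMeasure_succ (π : Policy k) (t : ℕ)
    {f : Hist k (t + 1) → ℝ≥0∞} (hf : Measurable f) :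
    ∫⁻ h, f h ∂refMeasure π (t + 1) =
      ∫⁻ h, ∑ a, π.act t h {a} * (∫⁻ x : ℝ, f (Fin.snoc h (a, x))) ∂refMeasure π t := by
  have hfs : Measurable fun z : Hist k t × (Fin k × ℝ) => f (Fin.snoc z.1 z.2) :=
    hf.comp measurable_snoc
  have hafs : Measurable fun z : Hist k t × (Fin k × ℝ) =>
      π.act t z.1 {z.2.1} * f (Fin.snoc z.1 z.2) := (measurable_act_singleton π t).mul hfs
  rw [refMeasure, lintegral_map hf measurable_snoc,
    lintegral_withDensity_eq_lintegral_mul _ (measurable_act_singleton π t) hfs]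
  refine (lintegral_prod _ hafs.aemeasurable).trans (lintegral_congr fun h => ?_)
  refine (lintegral_prod _ (hafs.comp measurable_prodMk_left).aemeasurable).trans ?_
  rw [lintegral_count, tsum_fintype]
  refine Finset.sum_congr rfl fun a _ => ?_
  have hfa : Measurable fun x => f (Fin.snoc h (a, x)) := hf.comp (measurable_snoc_right h a)
  change ∫⁻ x, π.act t h {a} * f (Fin.snoc h (a, x)) = _
  exact lintegral_const_mul _ hfa

theorem lintegral_gaussianReal_eq (m : ℝ) {f : ℝ → ℝ≥0∞} (hf : Measurable f) :
    ∫⁻ x, f x ∂gaussianReal m 1 = ∫⁻ x, ENNReal.ofReal (gaussianPDFReal m 1 x) * f x := by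
  rw [gaussianReal_of_var_ne_zero _ one_ne_zero,
    lintegral_withDensity_eq_lintegral_mul _ (measurable_gaussianPDF _ _) hf]
  rfl

theorem measurable_lintegral_snoc {t : ℕ} (a : Fin k) {f : Hist k (t + 1) → ℝ≥0∞}
    (hf : Measurable f) : Measurable fun z : (Fin k → ℝ) × Hist k t =>
      ∫⁻ x, f (Fin.snoc z.2 (a, x)) ∂gaussianReal (z.1 a) 1 := by
  have hfa : ∀ h : Hist k t, Measurable fun x => f (Fin.snoc h (a, x)) := fun h =>
    hf.comp (measurable_snoc_right h a)
  simp_rw [fun z : (Fin k → ℝ) × Hist k t => lintegral_gaussianReal_eq (z.1 a) (hfa z.2)]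
  have h1 : Measurable fun z : ((Fin k → ℝ) × Hist k t) × ℝ => z.1.1 a :=
    (measurable_pi_apply a).comp measurable_fst.fst
  have h2 : Measurable fun z : ((Fin k → ℝ) × Hist k t) × ℝ => f (Fin.snoc z.1.2 (a, z.2)) :=
    hf.comp ((measurable_snoc_apply a).comp (measurable_fst.snd.prodMk measurable_snd))
  exact Measurable.lintegral_prod_right (f := fun (z : (Fin k → ℝ) × Hist k t) x =>
      ENNReal.ofReal (gaussianPDFReal (z.1 a) 1 x) * f (Fin.snoc z.2 (a, x)))
    (Measurable.mul (measurable_gaussianPDFReal_comp h1 measurable_snd).ennreal_ofReal h2)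

theorem measurable_likelihood_mul {t : ℕ} {f : (Fin k → ℝ) × Hist k t → ℝ≥0∞}
    (hf : Measurable f) : Measurable fun z => likelihood z.1 z.2 * f z :=
  measurable_likelihood.mul hf

theorem lintegral_traj (θ : Fin k → ℝ) (π : Policy k) (t : ℕ) {f : Hist k t → ℝ≥0∞}
    (hf : Measurable f) :
    ∫⁻ h, f h ∂traj θ π.act t = ∫⁻ h, likelihood θ h * f h ∂refMeasure π t := by
  induction t with
  | zero =>
    rw [traj, refMeasure]
    simp [likelihood]
  | succ t ih =>
    have hL : Measurable fun h : Hist k (t + 1) => likelihood θ h * f h :=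
      (measurable_likelihood_comp measurable_const measurable_id).mul hf
    have hg : Measurable fun h : Hist k t =>
        ∑ a, π.act t h {a} * ∫⁻ x, f (Fin.snoc h (a, x)) ∂gaussianReal (θ a) 1 := by
      refine Finset.measurable_sum _ fun a _ => Measurable.mul ?_ ?_
      · exact (Measure.measurable_coe (measurableSet_singleton a)).comp (π.measurable_act t)
      · exact Measurable.lintegral_prod_right (f := fun h x => f (Fin.snoc h (a, x)))
          (hf.comp (measurable_snoc_apply a))
    rw [lintegral_traj_succ θ π t hf, ih hg, lintegral_refMeasure_succ π t hL]
    refine lintegral_congr fun h => ?_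
    rw [Finset.mul_sum]
    refine Finset.sum_congr rfl fun a _ => ?_
    have hfa : Measurable fun x => f (Fin.snoc h (a, x)) :=
      hf.comp (measurable_snoc_right h a)
    simp_rw [likelihood_snoc, mul_assoc]
    have hga : Measurable fun x =>
        ENNReal.ofReal (gaussianPDFReal (θ a) 1 x) * f (Fin.snoc h (a, x)) :=
      (measurable_gaussianPDFReal_comp measurable_const measurable_id).ennreal_ofReal.mul hfa
    rw [lintegral_gaussianReal_eq _ hfa, lintegral_const_mul _ hga, mul_left_comm]

variable (Q : Measure (Fin k → ℝ))

theorem lintegral_lintegral_traj (π : Policy k) (t : ℕ)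
    {f : (Fin k → ℝ) × Hist k t → ℝ≥0∞} (hf : Measurable f) :
    ∫⁻ θ, ∫⁻ h, f (θ, h) ∂traj θ π.act t ∂Q =
      ∫⁻ z, likelihood z.1 z.2 * f z ∂Q.prod (refMeasure π t) := by
  rw [lintegral_prod _ (measurable_likelihood_mul hf).aemeasurable]
  exact lintegral_congr fun θ => lintegral_traj θ π t (hf.comp measurable_prodMk_left)

theorem lintegral_traj_add (π : Policy k) (t : ℕ)
    {f g : (Fin k → ℝ) × Hist k t → ℝ≥0∞} (hf : Measurable f) (hg : Measurable g) :
    ∫⁻ θ, ∫⁻ h, f (θ, h) + g (θ, h) ∂traj θ π.act t ∂Q =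
      ∫⁻ θ, ∫⁻ h, f (θ, h) ∂traj θ π.act t ∂Q + ∫⁻ θ, ∫⁻ h, g (θ, h) ∂traj θ π.act t ∂Q := by
  rw [lintegral_lintegral_traj Q π t hf, lintegral_lintegral_traj Q π t hg,
    ← lintegral_add_left (measurable_likelihood_mul hf),
    lintegral_lintegral_traj Q π t (f := fun z => f z + g z) (hf.add hg)]
  simp_rw [mul_add]

theorem lintegral_traj_const_mul (π : Policy k) (t : ℕ) (c : ℝ≥0∞)
    {f : (Fin k → ℝ) × Hist k t → ℝ≥0∞} (hf : Measurable f) :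
    ∫⁻ θ, ∫⁻ h, c * f (θ, h) ∂traj θ π.act t ∂Q =
      c * ∫⁻ θ, ∫⁻ h, f (θ, h) ∂traj θ π.act t ∂Q := by
  rw [lintegral_lintegral_traj Q π t hf, ← lintegral_const_mul _ (measurable_likelihood_mul hf),
    lintegral_lintegral_traj Q π t (f := fun z => c * f z) (hf.const_mul c)]
  simp_rw [mul_left_comm]

/-- Given the history, the environment is distributed according to the posterior. -/
theorem lintegral_lintegral_traj_posterior [IsProbabilityMeasure Q] (π : Policy k) (t : ℕ)
    {f : (Fin k → ℝ) × Hist k t → ℝ≥0∞} (hf : Measurable f) :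
    ∫⁻ θ, ∫⁻ h, f (θ, h) ∂traj θ π.act t ∂Q =
      ∫⁻ θ, ∫⁻ h, ∫⁻ θ', f (θ', h) ∂posterior Q h ∂traj θ π.act t ∂Q := by
  have hp : Measurable fun z : (Fin k → ℝ) × Hist k t => ∫⁻ θ, f (θ, z.2) ∂posterior Q z.2 :=
    (measurable_lintegral_posterior Q hf).comp measurable_snd
  rw [lintegral_lintegral_traj Q π t hf, lintegral_lintegral_traj Q π t
      (f := fun z => ∫⁻ θ', f (θ', z.2) ∂posterior Q z.2) hp,
    lintegral_prod_symm _ (measurable_likelihood_mul hf).aemeasurable,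
    lintegral_prod_symm _ (measurable_likelihood_mul hp).aemeasurable]
  refine lintegral_congr fun h => ?_
  dsimp only
  rw [lintegral_mul_const _ (measurable_likelihood_left h)]
  exact (evidence_mul_lintegral_posterior Q h (hf.comp measurable_prodMk_right)).symm

end Trajectory

section GaussianMixture

theorem integrable_mul_gaussianPDFReal_iff (m : ℝ) {q : ℝ → ℝ} :
    Integrable (fun x => q x * gaussianPDFReal m 1 x) ↔ Integrable q (gaussianReal m 1) := by
  rw [gaussianReal_of_var_ne_zero _ one_ne_zero,
    integrable_withDensity_iff (measurable_gaussianPDF _ _) (by simp [gaussianPDF])]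
  simp only [toReal_gaussianPDF]

theorem integral_mul_gaussianPDFReal (m : ℝ) (q : ℝ → ℝ) :
    ∫ x, q x * gaussianPDFReal m 1 x = ∫ x, q x ∂gaussianReal m 1 := by
  rw [integral_gaussianReal_eq_integral_smul one_ne_zero]
  simp only [smul_eq_mul, mul_comm]

theorem integrable_sub_gaussianReal (m c : ℝ) : Integrable (fun x => x - c) (gaussianReal m 1) := by
  have h : Integrable id (gaussianReal m 1) :=
    memLp_one_iff_integrable.mp (memLp_id_gaussianReal 1)
  exact h.sub (integrable_const c)

theorem integrable_sub_sq_gaussianReal (m c : ℝ) :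
    Integrable (fun x => (x - c) ^ 2) (gaussianReal m 1) :=
  ((memLp_id_gaussianReal 2).sub (memLp_const c)).integrable_sq

theorem integral_sub_gaussianReal (m c : ℝ) : ∫ x, (x - c) ∂gaussianReal m 1 = m - c := by
  rw [integral_sub (by simpa using integrable_sub_gaussianReal m 0) (integrable_const c),
    integral_id_gaussianReal]
  simp

theorem integral_sub_sq_gaussianReal (m c : ℝ) :
    ∫ x, (x - c) ^ 2 ∂gaussianReal m 1 = 1 + (m - c) ^ 2 := by
  have hv : ∫ x, (x - m) ^ 2 ∂gaussianReal m 1 = 1 := by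
    have h := variance_eq_integral (μ := gaussianReal m 1) (X := id) aemeasurable_id
    rw [variance_id_gaussianReal] at h
    simp only [id_eq, integral_id_gaussianReal, NNReal.coe_one] at h
    exact h.symm
  have hsplit : ∀ x : ℝ, (x - c) ^ 2 = (x - m) ^ 2 + (2 * (m - c) * (x - m) + (m - c) ^ 2) := by
    intro x; ring
  have hlin := (integrable_sub_gaussianReal m m).const_mul (2 * (m - c))
  have hrem : Integrable (fun x => 2 * (m - c) * (x - m) + (m - c) ^ 2) (gaussianReal m 1) :=
    hlin.add (integrable_const _)
  rw [integral_congr_ae (.of_forall hsplit), integral_add (integrable_sub_sq_gaussianReal m m) hrem,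
    integral_add hlin (integrable_const _), integral_const_mul, integral_sub_gaussianReal, hv]
  simp

variable {Ω : Type*} [MeasurableSpace Ω]

/-- The density of the mixture under `μ` of the standard Gaussians centred at `T ω`. -/
noncomputable def mixDensity (μ : Measure Ω) (T : Ω → ℝ) (x : ℝ) : ℝ :=
  ∫ ω, gaussianPDFReal (T ω) 1 x ∂μ

variable {μ : Measure Ω} {T : Ω → ℝ}

theorem mixDensity_nonneg (x : ℝ) : 0 ≤ mixDensity μ T x :=
  integral_nonneg fun _ => gaussianPDFReal_nonneg _ _ _

variable [IsFiniteMeasure μ]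

theorem measurable_mixDensity (hT : Measurable T) : Measurable (mixDensity μ T) := by
  have h : Measurable fun z : Ω × ℝ => gaussianPDFReal (T z.1) 1 z.2 :=
    measurable_gaussianPDFReal_comp (hT.comp measurable_fst) measurable_snd
  exact (h.stronglyMeasurable.integral_prod_left').measurable

theorem integrable_gaussianPDFReal_comp (hT : Measurable T) (x : ℝ) :
    Integrable (fun ω => gaussianPDFReal (T ω) 1 x) μ := by
  refine Integrable.of_bound
    (measurable_gaussianPDFReal_comp hT measurable_const).aestronglyMeasurable 1 (.of_forall ?_)
  intro ω
  rw [Real.norm_of_nonneg (gaussianPDFReal_nonneg _ _ _)]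
  exact gaussianPDFReal_one_le_one _ _

theorem lintegral_gaussianPDFReal_comp (hT : Measurable T) (x : ℝ) :
    ∫⁻ ω, ENNReal.ofReal (gaussianPDFReal (T ω) 1 x) ∂μ = ENNReal.ofReal (mixDensity μ T x) :=
  (ofReal_integral_eq_lintegral_ofReal (integrable_gaussianPDFReal_comp hT x)
    (.of_forall fun _ => gaussianPDFReal_nonneg _ _ _)).symm

theorem integrable_mul_mixDensity (hT : Measurable T) {q : ℝ → ℝ} (hq : Measurable q)
    (hint : ∀ m, Integrable q (gaussianReal m 1)) {B : ℝ}
    (hB : ∀ᵐ ω ∂μ, ∫ x, |q x| ∂gaussianReal (T ω) 1 ≤ B) :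
    Integrable (fun x => q x * mixDensity μ T x) ∧
      ∫ x, q x * mixDensity μ T x = ∫ ω, ∫ x, q x ∂gaussianReal (T ω) 1 ∂μ := by
  have hm : Measurable fun z : Ω × ℝ => q z.2 * gaussianPDFReal (T z.1) 1 z.2 :=
    Measurable.mul (hq.comp measurable_snd)
      (measurable_gaussianPDFReal_comp (hT.comp measurable_fst) measurable_snd)
  have hprod : Integrable (fun z : Ω × ℝ => q z.2 * gaussianPDFReal (T z.1) 1 z.2)
      (μ.prod volume) := by
    rw [integrable_prod_iff hm.aestronglyMeasurable]
    refine ⟨.of_forall fun ω => ?_, ?_⟩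
    · exact (integrable_mul_gaussianPDFReal_iff (T ω)).mpr (hint _)
    have hnorm : Measurable fun z : Ω × ℝ => ‖q z.2 * gaussianPDFReal (T z.1) 1 z.2‖ := hm.norm
    refine Integrable.of_bound
      hnorm.stronglyMeasurable.integral_prod_right'.aestronglyMeasurable B ?_
    filter_upwards [hB] with ω hω
    rw [Real.norm_of_nonneg (integral_nonneg fun _ => norm_nonneg _)]
    simp only [norm_mul, Real.norm_eq_abs, abs_of_nonneg (gaussianPDFReal_nonneg _ _ _)]
    rwa [integral_mul_gaussianPDFReal _ fun x => |q x|]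
  have heq : ∀ x, q x * mixDensity μ T x = ∫ ω, q x * gaussianPDFReal (T ω) 1 x ∂μ :=
    fun x => (integral_const_mul _ _).symm
  simp_rw [heq]
  refine ⟨hprod.integral_prod_right, ?_⟩
  rw [← integral_integral_swap hprod]
  simp_rw [integral_mul_gaussianPDFReal _ q]

theorem integrable_mixDensity (hT : Measurable T) : Integrable (mixDensity μ T) := by
  have := (integrable_mul_mixDensity (μ := μ) hT (q := fun _ => 1) measurable_const
    (fun _ => integrable_const _) (B := 1) (by simp)).1
  simpa using this

theorem integral_mixDensity (hT : Measurable T) : ∫ x, mixDensity μ T x = μ.real Set.univ := by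
  have := (integrable_mul_mixDensity (μ := μ) hT (q := fun _ => 1) measurable_const
    (fun _ => integrable_const _) (B := 1) (by simp)).2
  simpa using this

theorem sub_half_sq_le {m : ℝ} (hm : m ∈ Set.Icc (0 : ℝ) 1) : (m - 1 / 2) ^ 2 ≤ 1 / 4 := by
  nlinarith [hm.1, hm.2]

theorem mixDensity_moment_one (hT : Measurable T) (h01 : ∀ᵐ ω ∂μ, T ω ∈ Set.Icc (0 : ℝ) 1) :
    Integrable (fun x => (x - 1 / 2) * mixDensity μ T x) ∧
      ∫ x, (x - 1 / 2) * mixDensity μ T x = ∫ ω, (T ω - 1 / 2) ∂μ := by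
  have h := integrable_mul_mixDensity (μ := μ) hT (q := fun x => x - 1 / 2) (by fun_prop)
    (fun m => integrable_sub_gaussianReal m _) (B := 9 / 4) ?_
  · simpa only [integral_sub_gaussianReal] using h
  filter_upwards [h01] with ω hω
  have hle : ∫ x, |x - 1 / 2| ∂gaussianReal (T ω) 1 ≤
      ∫ x, (1 + (x - 1 / 2) ^ 2) ∂gaussianReal (T ω) 1 := by
    refine integral_mono (integrable_sub_gaussianReal _ _).abs
      ((integrable_const _).add (integrable_sub_sq_gaussianReal _ _)) fun x => ?_
    rw [← sq_abs (x - 1 / 2)]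
    nlinarith [sq_nonneg (|x - 1 / 2| - 1), abs_nonneg (x - 1 / 2)]
  rw [integral_add (integrable_const _) (integrable_sub_sq_gaussianReal _ _),
    integral_sub_sq_gaussianReal] at hle
  simp only [integral_const, probReal_univ, one_smul] at hle
  linarith [sub_half_sq_le hω]

theorem mixDensity_moment_two (hT : Measurable T) (h01 : ∀ᵐ ω ∂μ, T ω ∈ Set.Icc (0 : ℝ) 1) :
    Integrable (fun x => (x - 1 / 2) ^ 2 * mixDensity μ T x) ∧
      ∫ x, (x - 1 / 2) ^ 2 * mixDensity μ T x ≤ 5 / 4 * μ.real Set.univ := by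
  have hB : ∀ᵐ ω ∂μ, ∫ x, (x - 1 / 2) ^ 2 ∂gaussianReal (T ω) 1 ≤ 5 / 4 := by
    filter_upwards [h01] with ω hω
    rw [integral_sub_sq_gaussianReal]
    linarith [sub_half_sq_le hω]
  have h := integrable_mul_mixDensity (μ := μ) hT (q := fun x => (x - 1 / 2) ^ 2) (by fun_prop)
    (fun m => integrable_sub_sq_gaussianReal m _) (B := 5 / 4) (by simpa only [abs_sq] using hB)
  refine ⟨h.1, ?_⟩
  rw [h.2]
  refine (integral_mono_of_nonneg (.of_forall fun ω => integral_nonneg fun x => sq_nonneg _)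
    (integrable_const (5 / 4)) hB).trans ?_
  simp [mul_comm]

theorem sub_mul_add_sqrt_mul_le {u v : ℝ} (hu : 0 ≤ u) (hv : 0 ≤ v) (y : ℝ) {s C : ℝ}
    (hs : 0 < s) (hC : 0 < C) :
    y * u - s ^ 2 * (y * v) + C * s ^ 2 * √(u * v) ≤
      (C * s)⁻¹ * (y ^ 2 * u + s ^ 2 * (y ^ 2 * v)) + C * s / 2 * (u + s ^ 2 * v) := by
  obtain ⟨a, ha, rfl⟩ : ∃ a, 0 ≤ a ∧ u = a ^ 2 := ⟨√u, Real.sqrt_nonneg _, (Real.sq_sqrt hu).symm⟩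
  obtain ⟨b, hb, rfl⟩ : ∃ b, 0 ≤ b ∧ v = b ^ 2 := ⟨√v, Real.sqrt_nonneg _, (Real.sq_sqrt hv).symm⟩
  rw [← mul_pow, Real.sqrt_sq (mul_nonneg ha hb)]
  set D := C * s
  have hD : 0 < D := mul_pos hC hs
  have h1 : 0 ≤ D⁻¹ * (y ^ 2 * (a - s * b) ^ 2 + (y * (a + s * b) - D * (a - s * b)) ^ 2) := by
    positivity
  have h2 : D⁻¹ * (y ^ 2 * (a - s * b) ^ 2 + (y * (a + s * b) - D * (a - s * b)) ^ 2) =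
      2 * (D⁻¹ * (y ^ 2 * a ^ 2 + s ^ 2 * (y ^ 2 * b ^ 2))) + D * (a - s * b) ^ 2 -
        2 * (y * a ^ 2 - s ^ 2 * (y * b ^ 2)) := by
    field_simp
    ring
  have h3 : C * s ^ 2 * (a * b) = D * s * a * b := by simp only [D]; ring
  rw [h3]
  nlinarith

end GaussianMixture

section InformationRatio

variable {Ω : Type*} [MeasurableSpace Ω] {μ : Measure Ω} [IsProbabilityMeasure μ] {T : Ω → ℝ}

theorem integrable_sqrt_mixDensity_mul (hT : Measurable T) (s : Set Ω) :
    Integrable fun x => √(mixDensity (μ.restrict s) T x * mixDensity μ T x) := by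
  refine ((integrable_mixDensity (μ := μ.restrict s) hT).add
    (integrable_mixDensity (μ := μ) hT)).mono'
    ((measurable_mixDensity hT).mul (measurable_mixDensity hT)).sqrt.aestronglyMeasurable
    (.of_forall fun x => ?_)
  have h1 := mixDensity_nonneg (μ := μ.restrict s) (T := T) x
  have h2 := mixDensity_nonneg (μ := μ) (T := T) x
  rw [Real.norm_of_nonneg (Real.sqrt_nonneg _), Pi.add_apply, Real.sqrt_le_left (by positivity)]
  nlinarith

theorem integral_sqrt_mixDensity_mul_le (hT : Measurable T) (s : Set Ω) :
    ∫ x, √(mixDensity (μ.restrict s) T x * mixDensity μ T x) ≤ √(μ.real s) := by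
  rcases (measureReal_nonneg (μ := μ) (s := s)).eq_or_lt with h0 | hpos
  · have : μ.restrict s = 0 := by
      rw [Measure.restrict_eq_zero, ← measureReal_eq_zero_iff]; exact h0.symm
    simp [this, mixDensity]
  set r := √(μ.real s)
  have hr : 0 < r := Real.sqrt_pos.mpr hpos
  have hrr : r ^ 2 = μ.real s := Real.sq_sqrt hpos.le
  have hφ := integrable_mixDensity (μ := μ.restrict s) hT
  have hψ := integrable_mixDensity (μ := μ) hT
  have hle : ∫ x, √(mixDensity (μ.restrict s) T x * mixDensity μ T x) ≤
      ∫ x, (r⁻¹ / 2 * mixDensity (μ.restrict s) T x + r / 2 * mixDensity μ T x) := by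
    refine integral_mono (integrable_sqrt_mixDensity_mul hT s)
      ((hφ.const_mul _).add (hψ.const_mul _)) fun x => ?_
    have h1 := mixDensity_nonneg (μ := μ.restrict s) (T := T) x
    have h2 := mixDensity_nonneg (μ := μ) (T := T) x
    refine Real.sqrt_le_iff.mpr ⟨by positivity, ?_⟩
    have h3 : r⁻¹ * r = 1 := inv_mul_cancel₀ hr.ne'
    generalize mixDensity (μ.restrict s) T x = u at *
    generalize mixDensity μ T x = v at *
    have h4 : u * v = (r⁻¹ * u) * (r * v) := by
      linear_combination (-(u * v)) * h3
    rw [h4]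
    nlinarith [sq_nonneg (r⁻¹ * u - r * v)]
  rw [integral_add (hφ.const_mul _) (hψ.const_mul _), integral_const_mul, integral_const_mul,
    integral_mixDensity hT, integral_mixDensity hT, measureReal_restrict_apply_univ,
    probReal_univ, ← hrr] at hle
  refine hle.trans (le_of_eq ?_)
  field_simp
  norm_num

theorem setIntegral_sub_add_integral_sqrt_mixDensity_le (hT : Measurable T)
    (h01 : ∀ᵐ ω ∂μ, T ω ∈ Set.Icc (0 : ℝ) 1) (s : Set Ω) {C : ℝ} (hC : 0 < C) :
    ∫ ω in s, T ω ∂μ - μ.real s * ∫ ω, T ω ∂μ +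
        C * (μ.real s * ∫ x, √(mixDensity (μ.restrict s) T x * mixDensity μ T x)) ≤
      5 / (2 * C) * √(μ.real s) + C * (μ.real s * √(μ.real s)) := by
  rcases (measureReal_nonneg (μ := μ) (s := s)).eq_or_lt with h0 | hpos
  · have : μ.restrict s = 0 := by
      rw [Measure.restrict_eq_zero, ← measureReal_eq_zero_iff]; exact h0.symm
    simp [this, ← h0]
  have hTint : Integrable T μ := Integrable.of_mem_Icc 0 1 hT.aemeasurable h01
  set r := √(μ.real s) with hr_def
  have hr : 0 < r := Real.sqrt_pos.mpr hpos
  have hrr : μ.real s = r ^ 2 := (Real.sq_sqrt hpos.le).symm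
  have h01s := ae_restrict_of_ae (s := s) h01
  have hφ := integrable_mixDensity (μ := μ.restrict s) hT
  have hψ := integrable_mixDensity (μ := μ) hT
  obtain ⟨hφ1, eφ1⟩ := mixDensity_moment_one hT h01s
  obtain ⟨hψ1, eψ1⟩ := mixDensity_moment_one hT h01
  obtain ⟨hφ2, eφ2⟩ := mixDensity_moment_two hT h01s
  obtain ⟨hψ2, eψ2⟩ := mixDensity_moment_two hT h01
  have hsq := integrable_sqrt_mixDensity_mul (μ := μ) hT s
  have hle := integral_mono ((hφ1.sub (hψ1.const_mul (r ^ 2))).add (hsq.const_mul (C * r ^ 2)))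
    (((hφ2.add (hψ2.const_mul (r ^ 2))).const_mul (C * r)⁻¹).add
      ((hφ.add (hψ.const_mul (r ^ 2))).const_mul (C * r / 2)))
    fun x => sub_mul_add_sqrt_mul_le (mixDensity_nonneg x) (mixDensity_nonneg x) (x - 1 / 2) hr hC
  rw [integral_add' (hφ1.sub (hψ1.const_mul (r ^ 2))) (hsq.const_mul (C * r ^ 2)),
    integral_sub' hφ1 (hψ1.const_mul (r ^ 2)),
    integral_add' ((hφ2.add (hψ2.const_mul (r ^ 2))).const_mul (C * r)⁻¹)
      ((hφ.add (hψ.const_mul (r ^ 2))).const_mul (C * r / 2)),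
    integral_const_mul, integral_const_mul, integral_const_mul, integral_const_mul,
    integral_add' hφ2 (hψ2.const_mul (r ^ 2)), integral_add' hφ (hψ.const_mul (r ^ 2)),
    integral_const_mul, integral_const_mul, integral_mixDensity hT, integral_mixDensity hT,
    eφ1, eψ1, integral_sub hTint.restrict (integrable_const _),
    integral_sub hTint (integrable_const _)] at hle
  simp only [integral_const, measureReal_restrict_apply_univ, probReal_univ, smul_eq_mul,
    hrr] at hle eφ2 eψ2 ⊢
  have hD : 0 < (C * r)⁻¹ := inv_pos.mpr (mul_pos hC hr)
  have hmom := mul_le_mul_of_nonneg_left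
    (add_le_add eφ2 (mul_le_mul_of_nonneg_left eψ2 (sq_nonneg r))) hD.le
  have e1 : (C * r)⁻¹ * (5 / 4 * r ^ 2 + r ^ 2 * (5 / 4 * 1)) = 5 / (2 * C) * r := by
    field_simp
    norm_num
  rw [e1] at hmom
  linear_combination hle + hmom

end InformationRatio

section ThompsonRegret

variable {k : ℕ} [NeZero k]

theorem sum_measureReal_bestArm (ρ : Measure (Fin k → ℝ)) [IsProbabilityMeasure ρ] :
    ∑ a : Fin k, ρ.real (bestArm ⁻¹' {a}) = 1 := by
  have : IsProbabilityMeasure (ρ.map bestArm) :=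
    Measure.isProbabilityMeasure_map measurable_bestArm.aemeasurable
  simp_rw [← map_measureReal_apply measurable_bestArm (measurableSet_singleton _)]
  rw [sum_measureReal_singleton, Finset.coe_univ, probReal_univ]

omit [NeZero k] in
theorem integrable_apply {ρ : Measure (Fin k → ℝ)} [IsFiniteMeasure ρ]
    (h01 : ∀ᵐ θ ∂ρ, ∀ a, θ a ∈ Set.Icc (0 : ℝ) 1) (a : Fin k) : Integrable (fun θ => θ a) ρ :=
  Integrable.of_mem_Icc 0 1 (measurable_pi_apply a).aemeasurable (h01.mono fun _ hθ => hθ a)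

theorem integrable_apply_bestArm {ρ : Measure (Fin k → ℝ)} [IsFiniteMeasure ρ]
    (h01 : ∀ᵐ θ ∂ρ, ∀ a, θ a ∈ Set.Icc (0 : ℝ) 1) : Integrable (fun θ => θ (bestArm θ)) ρ :=
  Integrable.of_mem_Icc 0 1 measurable_apply_bestArm.aemeasurable (h01.mono fun _ hθ => hθ _)

theorem integrable_const_mul_gap {ρ : Measure (Fin k → ℝ)} [IsFiniteMeasure ρ]
    (h01 : ∀ᵐ θ ∂ρ, ∀ a, θ a ∈ Set.Icc (0 : ℝ) 1) (c : ℝ) (a : Fin k) :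
    Integrable (fun θ => c * (θ (bestArm θ) - θ a)) ρ :=
  ((integrable_apply_bestArm h01).sub (integrable_apply h01 a)).const_mul c

theorem integral_apply_bestArm {ρ : Measure (Fin k → ℝ)} [IsProbabilityMeasure ρ]
    (h01 : ∀ᵐ θ ∂ρ, ∀ a, θ a ∈ Set.Icc (0 : ℝ) 1) :
    ∫ θ, θ (bestArm θ) ∂ρ = ∑ a, ∫ θ in bestArm ⁻¹' {a}, θ a ∂ρ := by
  have hint := integrable_apply h01
  have hset : ∀ a : Fin k, MeasurableSet (bestArm ⁻¹' {a} : Set (Fin k → ℝ)) := fun a =>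
    measurable_bestArm (measurableSet_singleton a)
  simp_rw [← integral_indicator (hset _)]
  rw [← integral_finsetSum _ fun a _ => (hint a).indicator (hset a)]
  congr 1 with θ
  rw [Finset.sum_eq_single (bestArm θ)]
  · simp
  · intro b _ hb
    simp [hb.symm]
  · simp

theorem sum_sqrt_measureReal_bestArm_le (ρ : Measure (Fin k → ℝ)) [IsProbabilityMeasure ρ] :
    ∑ a, √(ρ.real (bestArm ⁻¹' {a})) ≤ √k := by
  have hsum := sum_measureReal_bestArm ρ
  refine Real.le_sqrt_of_sq_le ?_
  have h := sq_sum_le_card_mul_sum_sq (s := (Finset.univ : Finset (Fin k)))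
    (f := fun a => √(ρ.real (bestArm ⁻¹' {a})))
  simpa [Real.sq_sqrt measureReal_nonneg, hsum] using h

/-- The expected regret of an action drawn from the law of the best arm is controlled by the
expected decrease of the potential `∑ b, √(P(bestArm = b))` when the reward is revealed. -/
theorem integral_gap_add_integral_sqrt_le (ρ : Measure (Fin k → ℝ)) [IsProbabilityMeasure ρ]
    (h01 : ∀ᵐ θ ∂ρ, ∀ a, θ a ∈ Set.Icc (0 : ℝ) 1) {C : ℝ} (hC : 0 < C) :
    ∫ θ, ∑ a, ρ.real (bestArm ⁻¹' {a}) * (θ (bestArm θ) - θ a) ∂ρ +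
        C * ∑ a, ρ.real (bestArm ⁻¹' {a}) * ∑ b,
          ∫ x, √(mixDensity (ρ.restrict (bestArm ⁻¹' {b})) (fun θ => θ a) x *
            mixDensity ρ (fun θ => θ a) x) ≤
      5 / (2 * C) * √k + C * ∑ b, √(ρ.real (bestArm ⁻¹' {b})) := by
  have hint := integrable_apply h01
  have hbest := integrable_apply_bestArm h01
  have hsum := sum_measureReal_bestArm ρ
  have hroot := sum_sqrt_measureReal_bestArm_le ρ
  set p : Fin k → ℝ := fun a => ρ.real (bestArm ⁻¹' {a})
  have hp : ∀ a, 0 ≤ p a := fun a => measureReal_nonneg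
  set H : Fin k → Fin k → ℝ := fun a b =>
    ∫ x, √(mixDensity (ρ.restrict (bestArm ⁻¹' {b})) (fun θ => θ a) x *
      mixDensity ρ (fun θ => θ a) x)
  have hgap : ∫ θ, ∑ a, p a * (θ (bestArm θ) - θ a) ∂ρ =
      ∑ a, (∫ θ in bestArm ⁻¹' {a}, θ a ∂ρ - p a * ∫ θ, θ a ∂ρ) := by
    rw [integral_finsetSum _ fun a _ => integrable_const_mul_gap h01 _ a]
    simp_rw [integral_const_mul, integral_sub hbest (hint _), mul_sub]
    rw [Finset.sum_sub_distrib, Finset.sum_sub_distrib, ← Finset.sum_mul, hsum, one_mul,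
      integral_apply_bestArm h01]
  have hH : ∀ a b, H a b ≤ √(p b) := fun a b =>
    integral_sqrt_mixDensity_mul_le (measurable_pi_apply a) _
  have hdiag : ∀ a, ∫ θ in bestArm ⁻¹' {a}, θ a ∂ρ - p a * ∫ θ, θ a ∂ρ + C * (p a * H a a) ≤
      5 / (2 * C) * √(p a) + C * (p a * √(p a)) := fun a =>
    setIntegral_sub_add_integral_sqrt_mixDensity_le (measurable_pi_apply a)
      (h01.mono fun θ hθ => hθ a) _ hC
  have harm : ∀ a, ∫ θ in bestArm ⁻¹' {a}, θ a ∂ρ - p a * ∫ θ, θ a ∂ρ + C * (p a * ∑ b, H a b) ≤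
      5 / (2 * C) * √(p a) + C * (p a * ∑ b, √(p b)) := by
    intro a
    have hoff : ∑ b ∈ Finset.univ.erase a, H a b ≤ ∑ b ∈ Finset.univ.erase a, √(p b) :=
      Finset.sum_le_sum fun b _ => hH a b
    have hoff' := mul_le_mul_of_nonneg_left (mul_le_mul_of_nonneg_left hoff (hp a)) hC.le
    rw [← Finset.add_sum_erase _ _ (Finset.mem_univ a),
      ← Finset.add_sum_erase _ (fun b => √(p b)) (Finset.mem_univ a)]
    linear_combination hdiag a + hoff'
  calc _ = ∑ a, (∫ θ in bestArm ⁻¹' {a}, θ a ∂ρ - p a * ∫ θ, θ a ∂ρ +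
        C * (p a * ∑ b, H a b)) := by
        rw [hgap, Finset.sum_add_distrib, Finset.mul_sum]
    _ ≤ ∑ a, (5 / (2 * C) * √(p a) + C * (p a * ∑ b, √(p b))) :=
        Finset.sum_le_sum fun a _ => harm a
    _ = 5 / (2 * C) * ∑ a, √(p a) + C * ∑ b, √(p b) := by
        rw [Finset.sum_add_distrib, ← Finset.mul_sum, ← Finset.mul_sum, ← Finset.sum_mul, hsum,
          one_mul]
    _ ≤ _ := by gcongr

variable (Q : Measure (Fin k → ℝ))

/-- The gap between the best mean reward and that of the arm `a`. -/
noncomputable def gap (θ : Fin k → ℝ) (a : Fin k) : ℝ≥0∞ :=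
  ENNReal.ofReal (θ (bestArm θ) - θ a)

/-- The sum of the square roots of the posterior probabilities that each arm is the best one. -/
noncomputable def potential {t : ℕ} (h : Hist k t) : ℝ≥0∞ :=
  ∑ b, ENNReal.ofReal √((posterior Q h).real (bestArm ⁻¹' {b}))

theorem measurable_gap : Measurable fun z : (Fin k → ℝ) × Fin k => gap z.1 z.2 :=
  ((measurable_apply_bestArm.comp measurable_fst).sub measurable_apply_prod).ennreal_ofReal

theorem measurable_gap_left (a : Fin k) : Measurable fun θ : Fin k → ℝ => gap θ a :=
  measurable_gap.comp measurable_prodMk_right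

variable [IsProbabilityMeasure Q]

theorem measurable_tsAct_singleton {t : ℕ} (a : Fin k) :
    Measurable fun h : Hist k t => tsAct Q h {a} :=
  (Measure.measurable_coe (measurableSet_singleton a)).comp (measurable_tsAct Q)

theorem measurable_potential {t : ℕ} : Measurable fun h : Hist k t => potential Q h := by
  unfold potential
  refine Finset.measurable_sum _ fun b _ => Measurable.ennreal_ofReal (Measurable.sqrt ?_)
  simp_rw [measureReal_def, ← tsAct_apply_singleton]
  exact (measurable_tsAct_singleton Q b).ennreal_toReal

theorem tsAct_singleton_eq_ofReal {t : ℕ} (h : Hist k t) (a : Fin k) :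
    tsAct Q h {a} = ENNReal.ofReal ((posterior Q h).real (bestArm ⁻¹' {a})) := by
  rw [tsAct_apply_singleton, ofReal_measureReal]

theorem mixDensity_mul_potential_snoc {t : ℕ} (h : Hist k t) (a : Fin k) (x : ℝ) :
    ENNReal.ofReal (mixDensity (posterior Q h) (fun θ => θ a) x) *
        potential Q (Fin.snoc h (a, x) : Hist k (t + 1)) =
      ENNReal.ofReal (∑ b, √(mixDensity ((posterior Q h).restrict (bestArm ⁻¹' {b}))
        (fun θ => θ a) x * mixDensity (posterior Q h) (fun θ => θ a) x)) := by
  have hψ0 := mixDensity_nonneg (μ := posterior Q h) (T := fun θ => θ a) x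
  rw [ENNReal.ofReal_sum_of_nonneg fun _ _ => Real.sqrt_nonneg _, potential, Finset.mul_sum]
  refine Finset.sum_congr rfl fun b _ => ?_
  rw [← ENNReal.ofReal_mul hψ0]
  congr 1
  have hset : MeasurableSet (bestArm ⁻¹' {b} : Set (Fin k → ℝ)) :=
    measurable_bestArm (measurableSet_singleton b)
  have hφ0 := mixDensity_nonneg (μ := (posterior Q h).restrict (bestArm ⁻¹' {b}))
    (T := fun θ => θ a) x
  rw [measureReal_def, posterior_apply_snoc Q h a x hset,
    lintegral_gaussianPDFReal_comp (measurable_pi_apply a),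
    lintegral_gaussianPDFReal_comp (measurable_pi_apply a), ENNReal.toReal_mul,
    ENNReal.toReal_inv, ENNReal.toReal_ofReal hψ0, ENNReal.toReal_ofReal hφ0]
  nth_rw 1 [← Real.sqrt_sq hψ0]
  rw [← Real.sqrt_mul (sq_nonneg _)]
  congr 1
  rcases hψ0.eq_or_lt with h0 | hpos
  · simp [← h0]
  · field_simp

theorem lintegral_lintegral_potential_snoc {t : ℕ} (h : Hist k t) (a : Fin k) :
    ∫⁻ θ, ∫⁻ x, potential Q (Fin.snoc h (a, x) : Hist k (t + 1)) ∂gaussianReal (θ a) 1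
        ∂posterior Q h =
      ENNReal.ofReal (∑ b, ∫ x, √(mixDensity ((posterior Q h).restrict (bestArm ⁻¹' {b}))
        (fun θ => θ a) x * mixDensity (posterior Q h) (fun θ => θ a) x)) := by
  have hpot : Measurable fun x : ℝ => potential Q (Fin.snoc h (a, x) : Hist k (t + 1)) :=
    (measurable_potential Q).comp (measurable_snoc_right h a)
  have hjoint : Measurable fun z : (Fin k → ℝ) × ℝ => ENNReal.ofReal (gaussianPDFReal (z.1 a) 1 z.2)
      * potential Q (Fin.snoc h (a, z.2) : Hist k (t + 1)) :=
    Measurable.mul (measurable_gaussianPDFReal_comp ((measurable_pi_apply a).comp measurable_fst)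
      measurable_snd).ennreal_ofReal (hpot.comp measurable_snd)
  simp_rw [lintegral_gaussianReal_eq _ hpot]
  rw [lintegral_lintegral_swap hjoint.aemeasurable]
  have hinner : ∀ x : ℝ, ∫⁻ θ, ENNReal.ofReal (gaussianPDFReal (θ a) 1 x) *
      potential Q (Fin.snoc h (a, x) : Hist k (t + 1)) ∂posterior Q h =
      ENNReal.ofReal (∑ b, √(mixDensity ((posterior Q h).restrict (bestArm ⁻¹' {b}))
        (fun θ => θ a) x * mixDensity (posterior Q h) (fun θ => θ a) x)) := by
    intro x
    rw [lintegral_mul_const _ (measurable_gaussianPDFReal_comp (measurable_pi_apply a)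
      measurable_const).ennreal_ofReal, lintegral_gaussianPDFReal_comp (measurable_pi_apply a),
      mixDensity_mul_potential_snoc]
  have hint : ∀ b : Fin k, Integrable fun x =>
      √(mixDensity ((posterior Q h).restrict (bestArm ⁻¹' {b})) (fun θ => θ a) x *
        mixDensity (posterior Q h) (fun θ => θ a) x) := fun b =>
    integrable_sqrt_mixDensity_mul (measurable_pi_apply a) _
  simp_rw [hinner]
  rw [← ofReal_integral_eq_lintegral_ofReal (integrable_finsetSum _ fun b _ => hint b)
    (.of_forall fun x => Finset.sum_nonneg fun b _ => Real.sqrt_nonneg _),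
    integral_finsetSum _ fun b _ => hint b]

theorem lintegral_sum_gap {t : ℕ} (h : Hist k t)
    (h01 : ∀ᵐ θ ∂posterior Q h, ∀ a, θ a ∈ Set.Icc (0 : ℝ) 1) :
    ∫⁻ θ, ∑ a, tsAct Q h {a} * gap θ a ∂posterior Q h =
      ENNReal.ofReal (∫ θ, ∑ a, (posterior Q h).real (bestArm ⁻¹' {a}) *
        (θ (bestArm θ) - θ a) ∂posterior Q h) := by
  have hnn : ∀ (θ : Fin k → ℝ) (a : Fin k),
      0 ≤ (posterior Q h).real (bestArm ⁻¹' {a}) * (θ (bestArm θ) - θ a) := fun θ a =>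
    mul_nonneg measureReal_nonneg (sub_nonneg.mpr (le_bestArm θ a))
  rw [ofReal_integral_eq_lintegral_ofReal
    (integrable_finsetSum _ fun a _ => integrable_const_mul_gap h01 _ a)
    (.of_forall fun θ => Finset.sum_nonneg fun a _ => hnn θ a)]
  refine lintegral_congr fun θ => ?_
  rw [ENNReal.ofReal_sum_of_nonneg fun a _ => hnn θ a]
  refine Finset.sum_congr rfl fun a _ => ?_
  rw [ENNReal.ofReal_mul measureReal_nonneg, tsAct_singleton_eq_ofReal, gap]

theorem lintegral_gap_add_potential_le {t : ℕ} (h : Hist k t)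
    (h01 : ∀ᵐ θ ∂Q, ∀ a, θ a ∈ Set.Icc (0 : ℝ) 1) {C : ℝ} (hC : 0 < C) :
    ∫⁻ θ, ∑ a, tsAct Q h {a} * gap θ a ∂posterior Q h +
        ENNReal.ofReal C * ∫⁻ θ, ∑ a, tsAct Q h {a} *
          ∫⁻ x, potential Q (Fin.snoc h (a, x) : Hist k (t + 1)) ∂gaussianReal (θ a) 1
          ∂posterior Q h ≤
      ENNReal.ofReal (5 / (2 * C) * √k) + ENNReal.ofReal C * potential Q h := by
  have h01' := (posterior_absolutelyContinuous Q h).ae_le h01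
  have hmeas : ∀ a : Fin k, Measurable fun θ : Fin k → ℝ =>
      ∫⁻ x, potential Q (Fin.snoc h (a, x) : Hist k (t + 1)) ∂gaussianReal (θ a) 1 := by
    intro a
    have hpot : Measurable fun x : ℝ => potential Q (Fin.snoc h (a, x) : Hist k (t + 1)) :=
      (measurable_potential Q).comp (measurable_snoc_right h a)
    simp_rw [lintegral_gaussianReal_eq _ hpot]
    exact Measurable.lintegral_prod_right (f := fun (θ : Fin k → ℝ) x =>
        ENNReal.ofReal (gaussianPDFReal (θ a) 1 x) *
          potential Q (Fin.snoc h (a, x) : Hist k (t + 1)))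
      (Measurable.mul (measurable_gaussianPDFReal_comp ((measurable_pi_apply a).comp measurable_fst)
        measurable_snd).ennreal_ofReal (hpot.comp measurable_snd))
  have hI : ∀ a b : Fin k, 0 ≤
      ∫ x, √(mixDensity ((posterior Q h).restrict (bestArm ⁻¹' {b})) (fun θ => θ a) x *
        mixDensity (posterior Q h) (fun θ => θ a) x) := fun a b =>
    integral_nonneg fun x => Real.sqrt_nonneg _
  have hIs : ∀ a : Fin k, 0 ≤ (posterior Q h).real (bestArm ⁻¹' {a}) *
      ∑ b, ∫ x, √(mixDensity ((posterior Q h).restrict (bestArm ⁻¹' {b})) (fun θ => θ a) x *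
        mixDensity (posterior Q h) (fun θ => θ a) x) := fun a =>
    mul_nonneg measureReal_nonneg (Finset.sum_nonneg fun b _ => hI a b)
  have hnn : ∀ (θ : Fin k → ℝ) (a : Fin k),
      0 ≤ (posterior Q h).real (bestArm ⁻¹' {a}) * (θ (bestArm θ) - θ a) := fun θ a =>
    mul_nonneg measureReal_nonneg (sub_nonneg.mpr (le_bestArm θ a))
  rw [lintegral_sum_gap Q h h01', lintegral_finsetSum _ fun a _ => (hmeas a).const_mul _]
  simp_rw [lintegral_const_mul _ (hmeas _), lintegral_lintegral_potential_snoc,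
    tsAct_singleton_eq_ofReal, ← ENNReal.ofReal_mul measureReal_nonneg]
  rw [← ENNReal.ofReal_sum_of_nonneg fun a _ => hIs a, ← ENNReal.ofReal_mul hC.le,
    ← ENNReal.ofReal_add (integral_nonneg fun θ => Finset.sum_nonneg fun a _ => hnn θ a)
      (mul_nonneg hC.le (Finset.sum_nonneg fun a _ => hIs a)), potential,
    ← ENNReal.ofReal_sum_of_nonneg fun a _ => Real.sqrt_nonneg _, ← ENNReal.ofReal_mul hC.le,
    ← ENNReal.ofReal_add (by positivity)
      (mul_nonneg hC.le (Finset.sum_nonneg fun a _ => Real.sqrt_nonneg _))]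
  exact ENNReal.ofReal_le_ofReal (integral_gap_add_integral_sqrt_le (posterior Q h) h01' hC)

/-- The expectation, over the prior and the interaction with Thompson Sampling, of a function of
the environment and the history. -/
noncomputable def tsExpect (t : ℕ) (f : (Fin k → ℝ) × Hist k t → ℝ≥0∞) : ℝ≥0∞ :=
  ∫⁻ θ, ∫⁻ h, f (θ, h) ∂traj θ (fun _ h => tsAct Q h) t ∂Q

theorem tsExpect_add {t : ℕ} {f g : (Fin k → ℝ) × Hist k t → ℝ≥0∞} (hf : Measurable f)
    (hg : Measurable g) :
    tsExpect Q t (fun z => f z + g z) = tsExpect Q t f + tsExpect Q t g :=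
  lintegral_traj_add Q (tsPolicy Q) t hf hg

theorem tsExpect_const_mul {t : ℕ} (c : ℝ≥0∞) {f : (Fin k → ℝ) × Hist k t → ℝ≥0∞}
    (hf : Measurable f) : tsExpect Q t (fun z => c * f z) = c * tsExpect Q t f :=
  lintegral_traj_const_mul Q (tsPolicy Q) t c hf

theorem tsExpect_posterior {t : ℕ} {f : (Fin k → ℝ) × Hist k t → ℝ≥0∞} (hf : Measurable f) :
    tsExpect Q t f = tsExpect Q t fun z => ∫⁻ θ, f (θ, z.2) ∂posterior Q z.2 :=
  lintegral_lintegral_traj_posterior Q (tsPolicy Q) t hf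

theorem tsExpect_const (t : ℕ) (c : ℝ≥0∞) : tsExpect Q t (fun _ => c) = c := by
  have := fun θ => isProbabilityMeasure_traj θ (tsPolicy Q) t
  simp only [tsPolicy] at this
  simp [tsExpect]

omit [IsProbabilityMeasure Q] in
theorem tsExpect_mono {t : ℕ} {f g : (Fin k → ℝ) × Hist k t → ℝ≥0∞} (h : ∀ z, f z ≤ g z) :
    tsExpect Q t f ≤ tsExpect Q t g :=
  lintegral_mono fun θ => lintegral_mono fun h' => h (θ, h')

theorem tsExpect_succ (t : ℕ) {f : (Fin k → ℝ) × Hist k (t + 1) → ℝ≥0∞} (hf : Measurable f) :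
    tsExpect Q (t + 1) f = tsExpect Q t fun z => ∑ a, tsAct Q z.2 {a} *
      ∫⁻ x, f (z.1, Fin.snoc z.2 (a, x)) ∂gaussianReal (z.1 a) 1 :=
  lintegral_congr fun θ => lintegral_traj_succ θ (tsPolicy Q) t (hf.comp measurable_prodMk_left)

/-- The regret accumulated along the history. -/
noncomputable def cumGap {t : ℕ} (z : (Fin k → ℝ) × Hist k t) : ℝ≥0∞ :=
  ∑ s, gap z.1 (z.2 s).1

theorem measurable_cumGap {t : ℕ} : Measurable (cumGap : (Fin k → ℝ) × Hist k t → ℝ≥0∞) := by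
  refine Finset.measurable_sum _ fun s _ => ?_
  have hs : Measurable fun z : (Fin k → ℝ) × Hist k t => (z.2 s).1 :=
    ((measurable_pi_apply s).comp measurable_snd).fst
  exact measurable_gap.comp (measurable_fst.prodMk hs)

theorem measurable_sum_tsAct_mul_gap {t : ℕ} :
    Measurable fun z : (Fin k → ℝ) × Hist k t => ∑ a, tsAct Q z.2 {a} * gap z.1 a :=
  Finset.measurable_sum _ fun a _ => Measurable.mul
    ((measurable_tsAct_singleton Q a).comp measurable_snd)
    ((measurable_gap_left a).comp measurable_fst)

theorem tsExpect_cumGap_succ (t : ℕ) :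
    tsExpect Q (t + 1) cumGap =
      tsExpect Q t cumGap + tsExpect Q t fun z => ∑ a, tsAct Q z.2 {a} * gap z.1 a := by
  rw [tsExpect_succ Q t measurable_cumGap,
    ← tsExpect_add Q measurable_cumGap (measurable_sum_tsAct_mul_gap Q)]
  congr 1 with z
  have hsum : ∑ a, tsAct Q z.2 {a} = 1 := sum_act_singleton (tsPolicy Q) t z.2
  simp only [cumGap, Fin.sum_univ_castSucc, Fin.snoc_castSucc, Fin.snoc_last, lintegral_const,
    measure_univ, mul_one, mul_add, Finset.sum_add_distrib]
  rw [← Finset.sum_mul, hsum, one_mul]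

theorem tsExpect_cumGap_add_potential_succ_le (t : ℕ)
    (h01 : ∀ᵐ θ ∂Q, ∀ a, θ a ∈ Set.Icc (0 : ℝ) 1) {C : ℝ} (hC : 0 < C) :
    tsExpect Q (t + 1) cumGap +
        ENNReal.ofReal C * tsExpect Q (t + 1) (fun z => potential Q z.2) ≤
      tsExpect Q t cumGap + ENNReal.ofReal C * tsExpect Q t (fun z => potential Q z.2) +
        ENNReal.ofReal (5 / (2 * C) * √k) := by
  have hpot : ∀ s : ℕ, Measurable fun z : (Fin k → ℝ) × Hist k s => potential Q z.2 := fun s =>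
    (measurable_potential Q).comp measurable_snd
  have hnext : Measurable fun z : (Fin k → ℝ) × Hist k t => ∑ a, tsAct Q z.2 {a} *
      ∫⁻ x, potential Q (Fin.snoc z.2 (a, x) : Hist k (t + 1)) ∂gaussianReal (z.1 a) 1 :=
    Finset.measurable_sum _ fun a _ => Measurable.mul
      ((measurable_tsAct_singleton Q a).comp measurable_snd)
      (measurable_lintegral_snoc a (measurable_potential Q))
  have hgap := measurable_sum_tsAct_mul_gap Q (t := t)
  have hpostgap : Measurable fun z : (Fin k → ℝ) × Hist k t =>
      ∫⁻ θ, ∑ a, tsAct Q z.2 {a} * gap θ a ∂posterior Q z.2 :=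
    (measurable_lintegral_posterior Q hgap).comp measurable_snd
  have hpostnext : Measurable fun z : (Fin k → ℝ) × Hist k t =>
      ∫⁻ θ, ∑ a, tsAct Q z.2 {a} *
        ∫⁻ x, potential Q (Fin.snoc z.2 (a, x) : Hist k (t + 1)) ∂gaussianReal (θ a) 1
        ∂posterior Q z.2 :=
    (measurable_lintegral_posterior Q hnext).comp measurable_snd
  have hstep : tsExpect Q t (fun z => ∑ a, tsAct Q z.2 {a} * gap z.1 a) +
      ENNReal.ofReal C * tsExpect Q (t + 1) (fun z => potential Q z.2) ≤
      ENNReal.ofReal (5 / (2 * C) * √k) +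
        ENNReal.ofReal C * tsExpect Q t (fun z => potential Q z.2) := by
    rw [tsExpect_succ Q t (hpot (t + 1)), tsExpect_posterior Q hgap, tsExpect_posterior Q hnext]
    refine (le_of_eq ?_).trans ((tsExpect_mono Q (t := t) fun z =>
      lintegral_gap_add_potential_le Q z.2 h01 hC).trans (le_of_eq ?_))
    · exact (congrArg _ (tsExpect_const_mul Q _ hpostnext).symm).trans
        (tsExpect_add Q hpostgap (hpostnext.const_mul _)).symm
    · rw [tsExpect_add Q measurable_const ((hpot t).const_mul _), tsExpect_const,
        tsExpect_const_mul Q _ (hpot t)]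
  rw [tsExpect_cumGap_succ, add_assoc, add_assoc]
  exact add_le_add_right (hstep.trans_eq (add_comm _ _)) _

theorem tsExpect_cumGap_add_potential_le (t : ℕ)
    (h01 : ∀ᵐ θ ∂Q, ∀ a, θ a ∈ Set.Icc (0 : ℝ) 1) {C : ℝ} (hC : 0 < C) :
    tsExpect Q t cumGap + ENNReal.ofReal C * tsExpect Q t (fun z => potential Q z.2) ≤
      ENNReal.ofReal (C * √k) + t * ENNReal.ofReal (5 / (2 * C) * √k) := by
  induction t with
  | zero =>
    have hpot : tsExpect Q 0 (fun z => potential Q z.2) ≤ ENNReal.ofReal √k := by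
      refine (tsExpect_mono Q fun z => ?_).trans_eq (tsExpect_const Q 0 _)
      rw [potential, ← ENNReal.ofReal_sum_of_nonneg fun _ _ => Real.sqrt_nonneg _]
      exact ENNReal.ofReal_le_ofReal (sum_sqrt_measureReal_bestArm_le _)
    have hgap : tsExpect Q 0 cumGap = 0 := by
      simp [tsExpect, cumGap]
    rw [hgap, zero_add, ENNReal.ofReal_mul hC.le]
    simpa using mul_le_mul_right hpot _
  | succ t ih =>
    refine (tsExpect_cumGap_add_potential_succ_le Q t h01 hC).trans
      ((add_le_add_left ih _).trans_eq ?_)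
    push_cast
    ring

omit [IsProbabilityMeasure Q] in
theorem bayesRegret_tsAct_le (n : ℕ) {B : ℝ} (hB0 : 0 ≤ B)
    (hB : tsExpect Q n cumGap ≤ ENNReal.ofReal B) :
    bayesRegret k n Q (fun _ h => tsAct Q h) ≤ B := by
  refine (Real.le_norm_self _).trans ((norm_integral_le_lintegral_norm _).trans
    (ENNReal.toReal_le_of_le_ofReal hB0 (le_trans (lintegral_mono fun θ => ?_) hB)))
  refine (ENNReal.ofReal_le_ofReal (norm_integral_le_lintegral_norm _)).trans
    (ENNReal.ofReal_toReal_le.trans (lintegral_mono fun h => ?_))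
  have hnn : ∀ s : Fin n, 0 ≤ (⨆ a, θ a) - θ (h s).1 := fun s => by
    rw [iSup_eq_bestArm]
    exact sub_nonneg.mpr (le_bestArm θ _)
  rw [Real.norm_of_nonneg (Finset.sum_nonneg fun s _ => hnn s),
    ENNReal.ofReal_sum_of_nonneg fun s _ => hnn s]
  simp only [cumGap, gap, iSup_eq_bestArm, le_refl]

end ThompsonRegret

end Bandit

open Bandit in
/-- For every `k ≥ 1`, `n ≥ 1` and every prior probability distribution `Q` over `k`-armed
bandit environments `θ ∈ [0,1]^k`, the Thompson Sampling policy under `Q` has Bayesian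
regret at most `14 * √(k * n)`. -/
theorem thompson_sampling_prior_independent_upper_bound
    (k n : ℕ) (hk : 1 ≤ k) (hn : 1 ≤ n)
    (Q : Measure (Fin k → ℝ)) (hQ : IsProbabilityMeasure Q)
    (hsupp : ∀ᵐ θ ∂Q, ∀ a, θ a ∈ Set.Icc (0 : ℝ) 1) :
    letI : NeZero k := ⟨Nat.one_le_iff_ne_zero.mp hk⟩
    bayesRegret k n Q (fun _t h => tsAct Q h) ≤ 14 * Real.sqrt (k * n) := by
  have : NeZero k := ⟨Nat.one_le_iff_ne_zero.mp hk⟩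
  have hn0 : (0 : ℝ) < n := by exact_mod_cast hn
  have hsqrt : 0 < √(n : ℝ) := Real.sqrt_pos.mpr hn0
  have hC : 0 < 5 / 2 * √(n : ℝ) := by positivity
  refine bayesRegret_tsAct_le Q n (by positivity) (le_self_add.trans
    ((tsExpect_cumGap_add_potential_le Q n hsupp hC).trans ?_))
  rw [← ENNReal.ofReal_natCast, ← ENNReal.ofReal_mul hn0.le,
    ← ENNReal.ofReal_add (by positivity) (by positivity)]
  refine ENNReal.ofReal_le_ofReal ?_
  have hround : (n : ℝ) * (5 / (2 * (5 / 2 * √(n : ℝ))) * √(k : ℝ)) = √k * √n := by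
    nth_rw 1 [← Real.sq_sqrt hn0.le]
    field_simp
  rw [hround, Real.sqrt_mul (Nat.cast_nonneg k)]
  have : 0 ≤ √(k : ℝ) * √(n : ℝ) := by positivity
  linarith
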